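/- Let m ≥ 2 and d = 2m. Let T ∈ S^d ℂ³ be a nonzero ternary form of degree d, and let A ⊆ ℙ²(ℂ) be a non-redundant finite set computing T, with r = ℓ(A). If k_{m−1}(A) = min{ binom(m+1,2), r }, h_A(m) = r, and r ≤ binom(m+2,2) − 2, then T has rank r and T is identifiable (A is the unique set of cardinality r computing T). -/

import Mathlib

open MvPolynomial

noncomputable section

/-- Projective n-space over ℂ, viewed as classes of linear forms (vectors in ℂ^{n+1}). -/
abbrev Proj (n : ℕ) := Projectivization ℂ (Fin (n + 1) → ℂ)

instance (n : ℕ) : DecidableEq (Proj n) := Classical.decEq _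

/-- The linear form with coefficient vector `v`. -/
def linForm (n : ℕ) (v : Fin (n + 1) → ℂ) : MvPolynomial (Fin (n + 1)) ℂ :=
  ∑ i, MvPolynomial.C (v i) * MvPolynomial.X i

/-- The `d`-th Veronese image of a projective point: the `d`-th power of (a representative of)
the corresponding linear form. -/
def vero (n d : ℕ) (P : Proj n) : MvPolynomial (Fin (n + 1)) ℂ :=
  linForm n P.rep ^ d

/-- `A` computes `T` : the class of `T` lies in the projective linear span of `v_d(A)`,
equivalently `T` lies in the linear span of the `d`-th powers of the points of `A`. -/
def Computes (n d : ℕ) (A : Finset (Proj n)) (T : MvPolynomial (Fin (n + 1)) ℂ) : Prop :=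
  T ∈ Submodule.span ℂ (vero n d '' (A : Set (Proj n)))

/-- `A` is a non-redundant set computing `T`. -/
def NRComputes (n d : ℕ) (A : Finset (Proj n)) (T : MvPolynomial (Fin (n + 1)) ℂ) : Prop :=
  Computes n d A T ∧ ∀ A' ⊂ A, ¬ Computes n d A' T

/-- The (Waring) rank of `T` : minimal cardinality of a finite set computing `T`. -/
def waringRank (n d : ℕ) (T : MvPolynomial (Fin (n + 1)) ℂ) : ℕ :=
  sInf {r | ∃ A : Finset (Proj n), A.card = r ∧ Computes n d A T}

/-- `T` is identifiable: there is exactly one finite set computing `T` whose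
cardinality equals the rank of `T`. -/
def Identifiable (n d : ℕ) (T : MvPolynomial (Fin (n + 1)) ℂ) : Prop :=
  ∃! A : Finset (Proj n), A.card = waringRank n d T ∧ Computes n d A T

/-- The evaluation map of degree `j` on the chosen homogeneous coordinates of `Z`. -/
def evalMap (n j : ℕ) (Z : Finset (Proj n)) :
    MvPolynomial.homogeneousSubmodule (Fin (n + 1)) ℂ j →ₗ[ℂ] (Z → ℂ) where
  toFun F := fun P => MvPolynomial.eval (P.1).rep F.1
  map_add' F G := by funext P; simp
  map_smul' c F := by funext P; simp

/-- The Hilbert function of the finite set `Z` (at a natural number `j`). -/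
def hilbN (n : ℕ) (Z : Finset (Proj n)) (j : ℕ) : ℕ :=
  Module.finrank ℂ (LinearMap.range (evalMap n j Z))

/-- The Hilbert function of the finite set `Z` (zero in negative degrees). -/
def hilb (n : ℕ) (Z : Finset (Proj n)) (j : ℤ) : ℕ :=
  if j < 0 then 0 else hilbN n Z j.toNat

/-- The first difference of the Hilbert function. -/
def Dhilb (n : ℕ) (Z : Finset (Proj n)) (j : ℤ) : ℤ :=
  (hilb n Z j : ℤ) - (hilb n Z (j - 1) : ℤ)

/-- The `d`-th Kruskal rank of `A` : the largest `k` such that every subset of `A`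
with at most `k` elements has linearly independent image under `v_d`. -/
def kruskalRank (n d : ℕ) (A : Finset (Proj n)) : ℕ :=
  sSup {k | k ≤ A.card ∧
    ∀ A' ⊆ A, A'.card ≤ k → LinearIndependent ℂ (fun P : A' => vero n d P.1)}

/-- The Cayley–Bacharach property in degree `d` for the finite set `Z`. -/
def CB (n d : ℕ) (Z : Finset (Proj n)) : Prop :=
  ∀ P ∈ Z, ∀ F : MvPolynomial (Fin (n + 1)) ℂ, F.IsHomogeneous d →
    (∀ Q ∈ Z, Q ≠ P → MvPolynomial.eval Q.rep F = 0) → MvPolynomial.eval P.rep F = 0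

end


lemma finrank_hom (j : ℕ) :
    Module.finrank ℂ (homogeneousSubmodule (Fin 3) ℂ j) = Nat.choose (j + 2) 2 := by
  classical
  have hfin : {d : Fin 3 →₀ ℕ | d.degree = j} = ↑((Finset.univ : Finset (Fin 3)).finsuppAntidiag j) := by
    ext d
    simp [Finset.mem_finsuppAntidiag, Finsupp.degree_eq_sum]
  rw [homogeneousSubmodule_eq_finsupp_supported, hfin]
  have b := basisRestrictSupport ℂ
    (↑((Finset.univ : Finset (Fin 3)).finsuppAntidiag j) : Set (Fin 3 →₀ ℕ))
  have h := Module.finrank_eq_card_basis b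
  have h2 : Fintype.card ↑(↑((Finset.univ : Finset (Fin 3)).finsuppAntidiag j) : Set (Fin 3 →₀ ℕ))
      = Nat.choose (j + 2) 2 := by
    simp only [Finset.coe_sort_coe, Fintype.card_coe]
    rw [Finset.card_finsuppAntidiag_nat_eq_choose]
    simp only [Finset.card_univ, Fintype.card_fin]
    rw [show 3 + j - 1 = j + 2 by omega, Nat.choose_symm_add]
  rw [← h2]
  exact h

instance hom_finite (j : ℕ) : Module.Finite ℂ (homogeneousSubmodule (Fin 3) ℂ j) :=
  Module.Finite.iff_fg.mpr (homogeneousSubmodule_fg (Fin 3) ℂ j)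

instance hom_finite' (j : ℕ) : Module.Finite ℂ (homogeneousSubmodule (Fin (2 + 1)) ℂ j) :=
  hom_finite j

/-- Apolarity: `∑ w_P L_P^d = 0` iff the weights kill all degree-`d` forms. -/
lemma apolar (d : ℕ) (Z : Finset (Proj 2)) (w : Proj 2 → ℂ) :
    (∑ P ∈ Z, w P • vero 2 d P = 0) ↔
      ∀ F : MvPolynomial (Fin 3) ℂ, F.IsHomogeneous d → ∑ P ∈ Z, w P * eval P.rep F = 0 := by
  have hco : ∀ (v : Fin 3 → ℂ) (s : Fin 3 →₀ ℕ), coeff s (linForm 2 v ^ d) =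
      if s.degree = d then s.multinomial * eval v (monomial s (1 : ℂ)) else 0 := by
    intro v s
    have := coeff_linearCombination_X_pow_of_fintype v s d
    simp only [linForm, ← smul_eq_C_mul]
    rw [this, eval_monomial, one_mul]
    rfl
  constructor
  · intro h F hF
    have hs : ∀ s : Fin 3 →₀ ℕ, s.degree = d →
        ∑ P ∈ Z, w P * eval P.rep (monomial s (1 : ℂ)) = 0 := by
      intro s hs
      have h1 := congrArg (coeff s) h
      simp only [coeff_sum, coeff_smul, vero, hco, hs, if_true, coeff_zero, smul_eq_mul] at h1
      have h2 : (s.multinomial : ℂ) ≠ 0 := by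
        have : s.multinomial ≠ 0 := by
          rw [Finsupp.multinomial]
          exact (Nat.multinomial_pos _ _).ne'
        exact_mod_cast this
      apply mul_left_cancel₀ h2
      rw [mul_zero, ← h1, Finset.mul_sum]
      exact Finset.sum_congr rfl fun P _ => by ring
    rw [F.as_sum]
    simp only [map_sum, Finset.mul_sum]
    rw [Finset.sum_comm]
    refine Finset.sum_eq_zero fun s hsF => ?_
    have h3 := hs s (by
      by_contra hne
      exact (mem_support_iff.mp hsF) (hF.coeff_eq_zero hne))
    have : ∀ P : Proj 2, w P * eval P.rep (monomial s (coeff s F)) =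
        coeff s F * (w P * eval P.rep (monomial s (1 : ℂ))) := by
      intro P
      simp only [eval_monomial]; ring
    simp only [this, ← Finset.mul_sum, h3, mul_zero]
  · intro h
    apply MvPolynomial.ext
    intro s
    simp only [coeff_sum, coeff_smul, vero, hco, coeff_zero, smul_eq_mul]
    split_ifs with hs
    · have := h (monomial s 1) (isHomogeneous_monomial _ hs)
      calc _ = (s.multinomial : ℂ) * ∑ P ∈ Z, w P * eval P.rep (monomial s (1 : ℂ)) := by
            rw [Finset.mul_sum]; exact Finset.sum_congr rfl fun P _ => by ring
        _ = 0 := by rw [this, mul_zero]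
    · simp

/-- The points of `Z` impose independent conditions on forms of degree `j`. -/
def Indep (j : ℕ) (Z : Finset (Proj 2)) : Prop :=
  ∀ w : Proj 2 → ℂ, (∀ F : MvPolynomial (Fin 3) ℂ, F.IsHomogeneous j →
    ∑ P ∈ Z, w P * eval P.rep F = 0) → ∀ P ∈ Z, w P = 0

lemma Indep.mono {j : ℕ} {Z Z' : Finset (Proj 2)} (h : Indep j Z) (hs : Z' ⊆ Z) : Indep j Z' := by
  classical
  intro w hw P hP
  have := h (fun Q => if Q ∈ Z' then w Q else 0) (by
    intro F hF
    refine Eq.trans ?_ (hw F hF)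
    rw [← Finset.sum_subset hs]
    · exact Finset.sum_congr rfl fun Q hQ => by simp [hQ]
    · intro Q _ hQ; simp [hQ]) P (hs hP)
  simpa [hP] using this

lemma rep_exists_ne (P : Proj 2) : ∃ i, P.rep i ≠ 0 := by
  by_contra h
  push Not at h
  exact P.rep_nonzero (funext h)

lemma Indep.succ {j : ℕ} {Z : Finset (Proj 2)} (h : Indep j Z) : Indep (j + 1) Z := by
  intro w hw P hP
  obtain ⟨i, hi⟩ := rep_exists_ne P
  have := h (fun Q => w Q * Q.rep i) (by
    intro F hF
    rw [← hw (F * X i) (hF.mul (isHomogeneous_X ℂ i))]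
    exact Finset.sum_congr rfl fun Q _ => by simp; ring) P hP
  simpa [hi] using this

lemma indep_of_linearIndependent {j : ℕ} {Z : Finset (Proj 2)}
    (h : LinearIndependent ℂ (fun P : Z => vero 2 j P.1)) : Indep j Z := by
  intro w hw P hP
  have h0 := (apolar j Z w).2 hw
  rw [← Finset.sum_coe_sort] at h0
  exact Fintype.linearIndependent_iff.1 h (fun P => w P.1) h0 ⟨P, hP⟩

lemma evalMap_surj_iff {j : ℕ} {Z : Finset (Proj 2)} :
    Indep j Z ↔ Function.Surjective (evalMap 2 j Z) := by
  classical
  constructor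
  · intro h
    rw [← LinearMap.range_eq_top]
    by_contra hne
    obtain ⟨f, hf0, hf⟩ := Submodule.exists_le_ker_of_lt_top _ (lt_top_iff_ne_top.2 hne)
    apply hf0
    have key : ∀ g : Z → ℂ, f g = ∑ P : Z, f (Pi.single P 1) * g P := by
      intro g
      conv_lhs => rw [pi_eq_sum_univ' g]
      simp only [map_sum, map_smul, smul_eq_mul]
      refine Finset.sum_congr rfl fun P _ => ?_
      rw [mul_comm]
    let w : Proj 2 → ℂ := fun P => if hP : P ∈ Z then f (Pi.single ⟨P, hP⟩ 1) else 0
    have hw := h w (by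
      intro F hF
      have h1 : f (evalMap 2 j Z ⟨F, hF⟩) = 0 := hf ⟨_, rfl⟩
      rw [key] at h1
      rw [← h1, ← Finset.sum_coe_sort]
      refine Finset.sum_congr rfl fun P _ => ?_
      simp [w, evalMap])
    apply LinearMap.ext
    intro g
    rw [key]
    refine Finset.sum_eq_zero fun P _ => ?_
    have := hw P.1 P.2
    simp only [w, P.2, dif_pos] at this
    simp [this]
  · intro h w hw P hP
    obtain ⟨F, hF⟩ := h (Pi.single ⟨P, hP⟩ 1)
    have h1 := hw F.1 F.2
    have h2 : ∀ Q : Z, eval Q.1.rep F.1 = (Pi.single ⟨P, hP⟩ 1 : Z → ℂ) Q := fun Q => congrFun hF Q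
    rw [← Finset.sum_coe_sort] at h1
    simp only [h2, Pi.single_apply] at h1
    simpa using h1

lemma hilbN_eq_card_iff {j : ℕ} {Z : Finset (Proj 2)} :
    hilbN 2 Z j = Z.card ↔ Indep j Z := by
  rw [evalMap_surj_iff, hilbN, ← LinearMap.range_eq_top]
  constructor
  · intro h
    apply Submodule.eq_top_of_finrank_eq
    rw [h]; simp
  · intro h
    rw [h]; simp

lemma Indep.finrank_ker {j : ℕ} {Z : Finset (Proj 2)} (h : Indep j Z) :
    Z.card + Module.finrank ℂ (LinearMap.ker (evalMap 2 j Z)) = Nat.choose (j + 2) 2 := by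
  have h1 := LinearMap.finrank_range_add_finrank_ker (evalMap 2 j Z)
  rw [finrank_hom] at h1
  have h2 := hilbN_eq_card_iff.2 h
  rw [hilbN] at h2
  rw [← h2]; exact h1

lemma mem_ker_evalMap {j : ℕ} {Z : Finset (Proj 2)} (F : homogeneousSubmodule (Fin 3) ℂ j) :
    F ∈ LinearMap.ker (evalMap 2 j Z) ↔ ∀ P ∈ Z, eval P.rep F.1 = 0 := by
  rw [LinearMap.mem_ker]
  constructor
  · intro h P hP
    exact congrFun h ⟨P, hP⟩
  · intro h
    funext P
    exact h P.1 P.2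


lemma catalecticant {m : ℕ} {A B : Finset (Proj 2)} (a b : Proj 2 → ℂ)
    (hab : ∀ F : MvPolynomial (Fin 3) ℂ, F.IsHomogeneous (2 * m) →
      ∑ P ∈ A, a P * eval P.rep F = ∑ P ∈ B, b P * eval P.rep F)
    (ha : ∀ P ∈ A, a P ≠ 0) (hA : Indep m A) :
    A.card ≤ B.card ∧ (B.card ≤ A.card → ∀ F : MvPolynomial (Fin 3) ℂ, F.IsHomogeneous m →
      (∀ P ∈ A, eval P.rep F = 0) → ∀ P ∈ B, eval P.rep F = 0) := by
  have hker : LinearMap.ker (evalMap 2 m B) ≤ LinearMap.ker (evalMap 2 m A) := by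
    intro F hF
    rw [mem_ker_evalMap] at hF ⊢
    intro P hP
    have := hA (fun P => a P * eval P.rep F.1) (by
      intro K hK
      have h1 := hab (F.1 * K) (by rw [two_mul]; exact IsHomogeneous.mul F.2 hK)
      have h2 : ∑ P ∈ B, b P * eval P.rep (F.1 * K) = 0 :=
        Finset.sum_eq_zero fun P hP => by simp [hF P hP]
      rw [h2] at h1
      rw [← h1]
      exact Finset.sum_congr rfl fun Q _ => by simp [mul_assoc]) P hP
    exact (mul_eq_zero.1 this).resolve_left (ha P hP)
  have h1 := hA.finrank_ker
  have h2 := LinearMap.finrank_range_add_finrank_ker (evalMap 2 m B)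
  have h3 : Module.finrank ℂ (LinearMap.range (evalMap 2 m B)) ≤ B.card := by
    have := Submodule.finrank_le (LinearMap.range (evalMap 2 m B))
    simpa using this
  have h4 : Module.finrank ℂ (homogeneousSubmodule (Fin (2 + 1)) ℂ m) = Nat.choose (m + 2) 2 :=
    finrank_hom m
  have h5 := Submodule.finrank_mono hker
  refine ⟨by omega, fun hle F hF hFA => ?_⟩
  have heq : LinearMap.ker (evalMap 2 m B) = LinearMap.ker (evalMap 2 m A) :=
    Submodule.eq_of_le_of_finrank_eq hker (by omega)
  have : (⟨F, hF⟩ : homogeneousSubmodule (Fin 3) ℂ m) ∈ LinearMap.ker (evalMap 2 m A) :=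
    (mem_ker_evalMap _).2 hFA
  rw [← heq, mem_ker_evalMap] at this
  exact this

/-- Two distinct points are separated by a linear form. -/
lemma exists_lin_sep {P Q : Proj 2} (h : P ≠ Q) :
    ∃ l : MvPolynomial (Fin 3) ℂ, l.IsHomogeneous 1 ∧ eval Q.rep l = 0 ∧ eval P.rep l ≠ 0 := by
  by_contra hcon
  push Not at hcon
  apply h
  have key : ∀ i j, Q.rep i * P.rep j = Q.rep j * P.rep i := by
    intro i j
    have := hcon (C (Q.rep i) * X j - C (Q.rep j) * X i)
      ((isHomogeneous_C_mul_X _ _).sub (isHomogeneous_C_mul_X _ _)) (by simp; ring)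
    simp at this
    exact sub_eq_zero.1 this
  obtain ⟨i, hi⟩ := rep_exists_ne Q
  rw [← P.mk_rep, ← Q.mk_rep, Projectivization.mk_eq_mk_iff']
  refine ⟨P.rep i / Q.rep i, ?_⟩
  funext j
  simp only [Pi.smul_apply, smul_eq_mul]
  field_simp
  rw [key i j]; ring

lemma exists_sep {j : ℕ} {A : Finset (Proj 2)} (hA : Indep j A) {Q : Proj 2} (hQ : Q ∉ A) :
    ∃ F : MvPolynomial (Fin 3) ℂ, F.IsHomogeneous (j + 1) ∧ (∀ P ∈ A, eval P.rep F = 0) ∧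
      eval Q.rep F ≠ 0 := by
  classical
  by_contra hcon
  push Not at hcon
  have hsurj := evalMap_surj_iff.1 hA.succ
  -- dual basis of forms
  have hF : ∀ P : A, ∃ F : MvPolynomial (Fin 3) ℂ, F.IsHomogeneous (j + 1) ∧
      ∀ R : A, eval R.1.rep F = if R = P then 1 else 0 := by
    intro P
    obtain ⟨F, hF⟩ := hsurj (fun R => if R = P then 1 else 0)
    exact ⟨F.1, F.2, fun R => congrFun hF R⟩
  choose f hf1 hf2 using hF
  let c : Proj 2 → ℂ := fun P => if hP : P ∈ A then eval Q.rep (f ⟨P, hP⟩) else 0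
  have hc : ∀ F : MvPolynomial (Fin 3) ℂ, F.IsHomogeneous (j + 1) →
      eval Q.rep F = ∑ P ∈ A, c P * eval P.rep F := by
    intro F hF
    have h0 := hcon (F - ∑ P : A, C (eval P.1.rep F) * f P)
      (hF.sub (IsHomogeneous.sum _ _ _ fun P _ => (hf1 P).C_mul _)) (by
        intro R hR
        simp only [map_sub, map_sum, map_mul, eval_C]
        have : ∀ P : A, eval R.rep (f P) = if (⟨R, hR⟩ : A) = P then 1 else 0 :=
          fun P => hf2 P ⟨R, hR⟩
        simp [this])
    rw [← Finset.sum_coe_sort]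
    simp only [map_sub, map_sum, map_mul, eval_C] at h0
    rw [sub_eq_zero.1 h0]
    refine Finset.sum_congr rfl fun P _ => ?_
    simp only [c, P.2, dif_pos]
    ring
  have hc0 : ∀ P ∈ A, c P = 0 := by
    intro P hP
    obtain ⟨l, hl1, hl2, hl3⟩ := exists_lin_sep (P := P) (Q := Q) (by rintro rfl; exact hQ hP)
    have := hA (fun P => c P * eval P.rep l) (by
      intro K hK
      have h1 := hc (K * l) (hK.mul hl1)
      simp only [map_mul, hl2, mul_zero] at h1
      rw [h1]
      exact Finset.sum_congr rfl fun R _ => by ring) P hP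
    exact (mul_eq_zero.1 this).resolve_right hl3
  obtain ⟨i, hi⟩ := rep_exists_ne Q
  have h1 := hc (X i ^ (j + 1)) (isHomogeneous_X_pow i _)
  rw [Finset.sum_eq_zero fun P hP => by rw [hc0 P hP, zero_mul]] at h1
  simp at h1
  exact hi h1

lemma mem_of_vanish {j : ℕ} {A : Finset (Proj 2)} (hA : Indep j A) {Q : Proj 2}
    (h : ∀ F : MvPolynomial (Fin 3) ℂ, F.IsHomogeneous (j + 1) → (∀ P ∈ A, eval P.rep F = 0) →
      eval Q.rep F = 0) : Q ∈ A := by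
  by_contra hQ
  obtain ⟨F, h1, h2, h3⟩ := exists_sep hA hQ
  exact h3 (h F h1 h2)

lemma Indep.of_le {j k : ℕ} {Z : Finset (Proj 2)} (h : Indep j Z) (hjk : j ≤ k) : Indep k Z := by
  induction k, hjk using Nat.le_induction with
  | base => exact h
  | succ n _ ih => exact ih.succ

lemma exists_indep (Z : Finset (Proj 2)) : ∃ j, Indep j Z := by
  induction Z using Finset.induction_on with
  | empty => exact ⟨0, fun w _ P hP => absurd hP (by simp)⟩
  | insert Q Z hQ ih =>
    obtain ⟨j, hj⟩ := ih
    refine ⟨j + 1, fun w hw => ?_⟩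
    obtain ⟨F, h1, h2, h3⟩ := exists_sep hj hQ
    have hwQ : w Q = 0 := by
      have := hw F h1
      rw [Finset.sum_insert hQ, Finset.sum_eq_zero fun P hP => by rw [h2 P hP, mul_zero]] at this
      simpa [h3] using this
    have := hj.succ w (by
      intro K hK
      have := hw K hK
      rwa [Finset.sum_insert hQ, hwQ, zero_mul, zero_add] at this)
    intro P hP
    rcases Finset.mem_insert.1 hP with rfl | hP
    · exact hwQ
    · exact this P hP


/-- Auxiliary map recording the grading. -/
noncomputable def gradMap :
    MvPolynomial (Fin 3) ℂ →ₐ[ℂ] Polynomial (MvPolynomial (Fin 3) ℂ) :=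
  aeval (fun i => Polynomial.C (X i) * Polynomial.X)

lemma gradMap_monomial (s : Fin 3 →₀ ℕ) (c : ℂ) :
    gradMap (monomial s c) = Polynomial.monomial s.degree (monomial s c) := by
  rw [gradMap, aeval_monomial, ← Polynomial.C_mul_X_pow_eq_monomial]
  simp only [Finsupp.prod, mul_pow, Finset.prod_mul_distrib]
  rw [Finset.prod_pow_eq_pow_sum, ← mul_assoc]
  congr 1
  simp only [← map_pow, ← map_prod]
  rw [show (algebraMap ℂ (Polynomial (MvPolynomial (Fin 3) ℂ))) c =
    Polynomial.C (C c) from rfl, ← map_mul, monomial_eq]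
  rfl

lemma gradMap_hom {F : MvPolynomial (Fin 3) ℂ} {n : ℕ} (hF : F.IsHomogeneous n) :
    gradMap F = Polynomial.monomial n F := by
  conv_lhs => rw [F.as_sum]
  conv_rhs => rw [F.as_sum]
  simp only [map_sum]
  refine Finset.sum_congr rfl fun s hs => ?_
  rw [gradMap_monomial]
  have : s.degree = n := by
    by_contra hne
    exact (mem_support_iff.mp hs) (hF.coeff_eq_zero hne)
  rw [this]

lemma gradMap_coeff (F : MvPolynomial (Fin 3) ℂ) (s : Fin 3 →₀ ℕ) :
    coeff s ((gradMap F).coeff s.degree) = coeff s F := by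
  conv_lhs => rw [F.as_sum]
  conv_rhs => rw [F.as_sum]
  simp only [map_sum, Polynomial.finsetSum_coeff, coeff_sum]
  refine Finset.sum_congr rfl fun t ht => ?_
  rw [gradMap_monomial, Polynomial.coeff_monomial]
  split_ifs with h
  · rfl
  · rw [coeff_monomial, if_neg (by rintro rfl; exact h rfl), coeff_zero]

lemma gradMap_ne {F : MvPolynomial (Fin 3) ℂ} (hF : F ≠ 0) : gradMap F ≠ 0 := by
  intro h
  apply hF
  apply MvPolynomial.ext
  intro s
  rw [← gradMap_coeff, h]; simp

lemma hom_of_trailing {F : MvPolynomial (Fin 3) ℂ}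
    (h : (gradMap F).natDegree = (gradMap F).natTrailingDegree) :
    F.IsHomogeneous (gradMap F).natDegree := by
  intro s hs
  rw [← gradMap_coeff] at hs
  have h1 : (gradMap F).coeff s.degree ≠ 0 := by
    intro h0; rw [h0] at hs; simp at hs
  have h2 := Polynomial.le_natDegree_of_ne_zero h1
  have h3 := Polynomial.natTrailingDegree_le_of_ne_zero h1
  have : s.degree = (gradMap F).natDegree := by omega
  rw [← this, Finsupp.degree_eq_weight_one]
  rfl
  
lemma hom_factor {p q : MvPolynomial (Fin 3) ℂ} {n : ℕ} (h : (p * q).IsHomogeneous n)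
    (hne : p * q ≠ 0) : ∃ i j, i + j = n ∧ p.IsHomogeneous i ∧ q.IsHomogeneous j := by
  have hp := left_ne_zero_of_mul hne
  have hq := right_ne_zero_of_mul hne
  have h1 := gradMap_hom h
  rw [map_mul] at h1
  have h2 := congrArg Polynomial.natDegree h1
  have h3 := congrArg Polynomial.natTrailingDegree h1
  rw [Polynomial.natDegree_mul (gradMap_ne hp) (gradMap_ne hq),
    Polynomial.natDegree_monomial_eq _ hne] at h2
  rw [Polynomial.natTrailingDegree_mul (gradMap_ne hp) (gradMap_ne hq),
    Polynomial.natTrailingDegree_monomial hne] at h3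
  have h4 := Polynomial.natTrailingDegree_le_natDegree (gradMap p)
  have h5 := Polynomial.natTrailingDegree_le_natDegree (gradMap q)
  exact ⟨_, _, h2, hom_of_trailing (by omega), hom_of_trailing (by omega)⟩

lemma hom_cancel {H q : MvPolynomial (Fin 3) ℂ} {a n : ℕ} (hH : H.IsHomogeneous a) (h0 : H ≠ 0)
    (h : (H * q).IsHomogeneous (a + n)) : q.IsHomogeneous n := by
  by_cases hq : q = 0
  · rw [hq]; exact isHomogeneous_zero _ _ _
  · obtain ⟨i, j, hij, h1, h2⟩ := hom_factor h (mul_ne_zero h0 hq)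
    have := h1.inj_right hH h0
    have : j = n := by omega
    rwa [this] at h2

lemma gradMap_coeff_hom (u : MvPolynomial (Fin 3) ℂ) (k : ℕ) :
    ((gradMap u).coeff k).IsHomogeneous k := by
  rw [u.as_sum]
  simp only [map_sum, Polynomial.finsetSum_coeff]
  refine IsHomogeneous.sum _ _ _ fun s _ => ?_
  rw [gradMap_monomial, Polynomial.coeff_monomial]
  split_ifs with h
  · exact isHomogeneous_monomial _ h
  · exact isHomogeneous_zero _ _ _

lemma comp_mul {H : MvPolynomial (Fin 3) ℂ} {a k : ℕ} (hH : H.IsHomogeneous a) (hak : a ≤ k)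
    (u : MvPolynomial (Fin 3) ℂ) :
    (gradMap (u * H)).coeff k = (gradMap u).coeff (k - a) * H := by
  obtain ⟨n, rfl⟩ := Nat.exists_eq_add_of_le' hak
  rw [map_mul, gradMap_hom hH, Polynomial.coeff_mul_monomial, Nat.add_sub_cancel]

lemma eval_smul_hom {F : MvPolynomial (Fin 3) ℂ} {k : ℕ} (hF : F.IsHomogeneous k) (c : ℂ)
    (v : Fin 3 → ℂ) : eval (fun i => c * v i) F = c ^ k * eval v F := by
  rw [eval_eq', eval_eq', Finset.mul_sum]
  refine Finset.sum_congr rfl fun s hs => ?_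
  have : s.degree = k := by
    by_contra hne
    exact (mem_support_iff.mp hs) (hF.coeff_eq_zero hne)
  simp only [mul_pow, Finset.prod_mul_distrib]
  rw [Finset.prod_pow_eq_pow_sum, ← Finsupp.degree_eq_sum, this]
  ring

lemma two_choose (k : ℕ) : 2 * Nat.choose (k + 2) 2 = (k + 2) * (k + 1) := by
  rw [Nat.choose_two_right]
  have := Nat.div_mul_cancel (Nat.even_mul_pred_self (k + 2)).two_dvd
  simp only [Nat.add_succ_sub_one] at this ⊢
  linarith

lemma lift_poly (p : Polynomial ℂ) (n : ℕ) (hp : p.natDegree ≤ n) (k : Fin 3) :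
    ∃ u : MvPolynomial (Fin 3) ℂ, u.IsHomogeneous n ∧
      ∀ v : Fin 3 → ℂ, v 1 = 1 → eval v u = p.eval (v k) := by
  refine ⟨∑ i ∈ Finset.range (n + 1), C (p.coeff i) * (X 1 ^ (n - i) * X k ^ i), ?_, ?_⟩
  · refine IsHomogeneous.sum _ _ _ fun i hi => ?_
    have hi := Finset.mem_range.1 hi
    have := ((isHomogeneous_X_pow (R := ℂ) (1 : Fin 3) (n - i)).mul
      (isHomogeneous_X_pow (R := ℂ) k i)).C_mul (p.coeff i)
    rwa [Nat.sub_add_cancel (by omega)] at this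
  · intro v hv
    rw [Polynomial.eval_eq_sum_range' (n := n + 1) (by omega)]
    simp [hv]

/-- Multiplication by a form as a linear map between graded pieces. -/
noncomputable def mulMap {H : MvPolynomial (Fin 3) ℂ} {a : ℕ} (hH : H.IsHomogeneous a) (n : ℕ) :
    homogeneousSubmodule (Fin 3) ℂ n →ₗ[ℂ] homogeneousSubmodule (Fin 3) ℂ (n + a) :=
  (LinearMap.mulRight ℂ H).restrict (fun _ hx => IsHomogeneous.mul hx hH)

lemma mulMap_coe {H : MvPolynomial (Fin 3) ℂ} {a : ℕ} (hH : H.IsHomogeneous a) (n : ℕ)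
    (u : homogeneousSubmodule (Fin 3) ℂ n) : (mulMap hH n u).1 = u.1 * H := rfl

lemma exists_good_t {a : ℕ} {H1 H2 : MvPolynomial (Fin 3) ℂ} (h1 : H1.IsHomogeneous a)
    (h2 : H2.IsHomogeneous a) (hne : H1 ≠ 0) (hrel : IsRelPrime H1 H2) :
    ∃ t : ℂ, ∀ z, eval ![t, 1, z] H1 ≠ 0 ∨ eval ![t, 1, z] H2 ≠ 0 := by
  by_contra hcon
  push Not at hcon
  choose z hz1 hz2 using hcon
  let N := a ^ 2 + 1
  let p := a ^ 2
  let n := p + a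
  let Φ : homogeneousSubmodule (Fin 3) ℂ n × homogeneousSubmodule (Fin 3) ℂ n →ₗ[ℂ]
      homogeneousSubmodule (Fin 3) ℂ (n + a) := (mulMap h1 n).coprod (mulMap h2 n)
  let Ψ : homogeneousSubmodule (Fin 3) ℂ p →ₗ[ℂ]
      homogeneousSubmodule (Fin 3) ℂ n × homogeneousSubmodule (Fin 3) ℂ n :=
    (-(mulMap h2 p)).prod (mulMap h1 p)
  let E : homogeneousSubmodule (Fin 3) ℂ (n + a) →ₗ[ℂ] (Fin N → ℂ) :=
    { toFun := fun F i => eval ![((i : ℕ) : ℂ), 1, z ((i : ℕ) : ℂ)] F.1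
      map_add' := fun F G => by funext P; simp
      map_smul' := fun c F => by funext P; simp }
  have hE : LinearMap.range E = ⊤ := by
    rw [LinearMap.range_eq_top]
    intro g
    let v : Fin N → ℂ := fun i => ((i : ℕ) : ℂ)
    have hv : Set.InjOn v (Finset.univ : Finset (Fin N)) := by
      intro i _ j _ hij
      exact Fin.ext (Nat.cast_injective hij)
    obtain ⟨u, hu, hu2⟩ := lift_poly (Lagrange.interpolate Finset.univ v g) (n + a) (by
      have := Lagrange.degree_interpolate_lt g hv
      rw [Finset.card_univ, Fintype.card_fin] at this
      have h3 : (Lagrange.interpolate Finset.univ v g).natDegree < N := by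
        by_cases h0 : Lagrange.interpolate Finset.univ v g = 0
        · rw [h0, Polynomial.natDegree_zero]
          simp only [N]
          omega
        · exact (Polynomial.natDegree_lt_iff_degree_lt h0).2 this
      simp only [N, n, p] at h3 ⊢
      omega) 0
    refine ⟨⟨u, hu⟩, ?_⟩
    funext i
    have := hu2 ![v i, 1, z (v i)] (by simp)
    rw [show (E ⟨u, hu⟩) i = eval ![v i, 1, z (v i)] u from rfl, this]
    simp only [Matrix.cons_val_zero]
    exact Lagrange.eval_interpolate_at_node g hv (Finset.mem_univ i)
  have hΦE : LinearMap.range Φ ≤ LinearMap.ker E := by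
    rintro _ ⟨⟨u, v⟩, rfl⟩
    rw [LinearMap.mem_ker]
    funext i
    change eval _ (u.1 * H1 + v.1 * H2) = 0
    simp [hz1, hz2]
  have hker : LinearMap.ker Φ ≤ LinearMap.range Ψ := by
    rintro ⟨u, v⟩ h
    have h0 : u.1 * H1 + v.1 * H2 = 0 := congrArg Subtype.val (LinearMap.mem_ker.1 h)
    have hd : H1 ∣ v.1 := by
      apply hrel.dvd_of_dvd_mul_right
      exact ⟨-u.1, by linear_combination h0⟩
    obtain ⟨q, hq⟩ := hd
    have hqh : q.IsHomogeneous p := hom_cancel h1 hne (by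
      rw [← hq, add_comm]; exact v.2)
    refine ⟨⟨q, hqh⟩, ?_⟩
    have hu : u.1 = -(q * H2) := by
      apply mul_right_cancel₀ hne
      rw [hq] at h0
      linear_combination h0
    refine Prod.ext (Subtype.ext ?_) (Subtype.ext ?_)
    · exact hu.symm
    · rw [hq, mul_comm]; rfl
  have e1 := LinearMap.finrank_range_add_finrank_ker Φ
  have e2 := LinearMap.finrank_range_add_finrank_ker E
  have e3 := Submodule.finrank_mono hker
  have e4 := Submodule.finrank_mono hΦE
  have e5 := LinearMap.finrank_range_le Ψ
  rw [Module.finrank_prod, finrank_hom] at e1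
  rw [finrank_hom, hE, finrank_top] at e2
  rw [finrank_hom] at e5
  simp only [Module.finrank_fintype_fun_eq_card, Fintype.card_fin] at e2
  have t1 := two_choose n
  have t2 := two_choose p
  have t3 := two_choose (n + a)
  have hN : N = a ^ 2 + 1 := rfl
  have hn : n = p + a := rfl
  clear hE hΦE hker
  clear_value Φ Ψ E
  generalize Module.finrank ℂ Φ.range = x1, Module.finrank ℂ Φ.ker = x2, Module.finrank ℂ Ψ.range = x3, Module.finrank ℂ E.ker = x4 at *
  clear Φ Ψ E
  clear_value N n p
  subst hn
  nlinarith


lemma line_dvd {D : MvPolynomial (Fin 3) ℂ} {k : ℕ} (hD : D.IsHomogeneous k) (t : ℂ)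
    (h : ∀ z, eval ![t, 1, z] D = 0) : (X 0 - C t * X 1) ∣ D := by
  let g : Fin 3 → MvPolynomial (Fin 3) ℂ := ![C t * X 1, X 1, X 2]
  have hev : ∀ v : Fin 3 → ℂ, eval v (aeval g D) = eval ![t * v 1, v 1, v 2] D := by
    intro v
    have : (eval v).comp (aeval g : MvPolynomial (Fin 3) ℂ →ₐ[ℂ] _).toRingHom
        = eval ![t * v 1, v 1, v 2] := by
      apply MvPolynomial.ringHom_ext
      · intro r; simp
      · intro i; fin_cases i <;> simp [g]
    exact congrArg (fun f => f D) this
  have h0 : aeval g D = 0 := by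
    have hX : (X 1 : MvPolynomial (Fin 3) ℂ) * aeval g D = 0 := by
      apply MvPolynomial.funext
      intro v
      rw [map_mul, hev, eval_X, map_zero]
      by_cases hv : v 1 = 0
      · rw [hv, zero_mul]
      · have := eval_smul_hom hD (v 1) ![t, 1, v 2 / v 1]
        rw [h, mul_zero] at this
        have h2 : (fun i => v 1 * (![t, 1, v 2 / v 1] : Fin 3 → ℂ) i)
            = ![t * v 1, v 1, v 2] := by
          funext i
          fin_cases i
          · simp [mul_comm]
          · simp
          · simp; field_simp
        rw [h2] at this
        rw [this, mul_zero]
    exact (mul_eq_zero.1 hX).resolve_left (X_ne_zero _)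
  rw [← Ideal.mem_span_singleton, ← Ideal.Quotient.eq_zero_iff_mem]
  let I := Ideal.span {(X 0 - C t * X 1 : MvPolynomial (Fin 3) ℂ)}
  have : (Ideal.Quotient.mk I).comp (aeval g : MvPolynomial (Fin 3) ℂ →ₐ[ℂ] _).toRingHom
      = Ideal.Quotient.mk I := by
    apply MvPolynomial.ringHom_ext
    · intro r; simp [algebraMap_eq]
    · intro i
      fin_cases i
      · simp only [g]
        simp
        rw [← map_mul]
        refine (Ideal.Quotient.eq.2 ?_).symm
        exact Ideal.subset_span rfl
      · simp [g]
      · simp [g]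
  have h3 := congrArg (fun f => f D) this
  change Ideal.Quotient.mk I (aeval g D) = Ideal.Quotient.mk I D at h3
  rw [← h3, h0, map_zero]

/-- Restriction to an affine line. -/
noncomputable def restr (t : ℂ) : MvPolynomial (Fin 3) ℂ →ₐ[ℂ] Polynomial ℂ :=
  aeval ![Polynomial.C t, 1, Polynomial.X]

lemma restr_eval (t z : ℂ) (F : MvPolynomial (Fin 3) ℂ) :
    (restr t F).eval z = eval ![t, 1, z] F := by
  have : (Polynomial.evalRingHom z).comp (restr t).toRingHom = eval ![t, 1, z] := by
    apply MvPolynomial.ringHom_ext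
    · intro r; simp
    · intro i; fin_cases i <;> simp [restr]
  exact congrArg (fun f => f F) this

lemma restr_monomial (t : ℂ) (s : Fin 3 →₀ ℕ) (c : ℂ) :
    restr t (monomial s c) = Polynomial.monomial (s 2) (c * t ^ s 0) := by
  rw [restr, aeval_monomial, Finsupp.prod_fintype _ _ (by simp), Fin.prod_univ_three]
  simp [← Polynomial.C_mul_X_pow_eq_monomial, Polynomial.algebraMap_eq, mul_assoc]

lemma restr_deg (t : ℂ) {F : MvPolynomial (Fin 3) ℂ} {k : ℕ} (hF : F.IsHomogeneous k) :
    (restr t F).natDegree ≤ k ∧ (restr t F).coeff k = eval ![0, 0, 1] F := by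
  have key : ∀ s ∈ F.support, s 0 + s 1 + s 2 = k := by
    intro s hs
    have : s.degree = k := by
      by_contra hne
      exact (mem_support_iff.mp hs) (hF.coeff_eq_zero hne)
    rw [Finsupp.degree_eq_sum, Fin.sum_univ_three] at this
    exact this
  constructor
  · rw [F.as_sum, map_sum]
    refine Polynomial.natDegree_sum_le_of_forall_le _ _ fun s hs => ?_
    rw [restr_monomial]
    refine (Polynomial.natDegree_monomial_le _).trans ?_
    have := key s hs
    omega
  · rw [eval_eq']
    conv_lhs => rw [F.as_sum]
    rw [map_sum, Polynomial.finsetSum_coeff]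
    refine Finset.sum_congr rfl fun s hs => ?_
    have := key s hs
    rw [restr_monomial, Polynomial.coeff_monomial, Fin.prod_univ_three]
    simp only [Matrix.cons_val_zero, Matrix.cons_val_one, Matrix.cons_val]
    split_ifs with h
    · have e0 : s 0 = 0 := by omega
      have e1 : s 1 = 0 := by omega
      simp [e0, e1]
    · by_cases e0 : s 0 = 0
      · have e1 : s 1 ≠ 0 := by omega
        simp [e1]
      · simp [e0]

lemma ci_special {a : ℕ} (ha : 1 ≤ a) {H1 H2 : MvPolynomial (Fin 3) ℂ} (h1 : H1.IsHomogeneous a)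
    (h2 : H2.IsHomogeneous a) (hrel : IsRelPrime H1 H2) (hp : eval ![0, 0, 1] H1 ≠ 0) :
    ∃ l : MvPolynomial (Fin 3) ℂ, l.IsHomogeneous 1 ∧ ∀ k, 2 * a ≤ k →
      ∀ F : MvPolynomial (Fin 3) ℂ, F.IsHomogeneous k → ∃ K u v : MvPolynomial (Fin 3) ℂ,
        K.IsHomogeneous (k - 1) ∧ F = l * K + u * H1 + v * H2 := by
  have hne : H1 ≠ 0 := by rintro rfl; simp at hp
  obtain ⟨t, ht⟩ := exists_good_t h1 h2 hne hrel
  have hl : (X 0 - C t * X 1 : MvPolynomial (Fin 3) ℂ).IsHomogeneous 1 :=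
    (isHomogeneous_X _ _).sub ((isHomogeneous_X _ _).C_mul _)
  have hl0 : (X 0 - C t * X 1 : MvPolynomial (Fin 3) ℂ) ≠ 0 := by
    intro h
    have := congrArg (eval ![1, 0, 0]) h
    simp at this
  refine ⟨_, hl, fun k hk F hF => ?_⟩
  have hcop : IsCoprime (restr t H1) (restr t H2) := by
    rw [Polynomial.isCoprime_iff_aeval_ne_zero_of_isAlgClosed (k := ℂ) (K := ℂ)]
    intro z
    simp only [Polynomial.coe_aeval_eq_eval, restr_eval]
    exact ht z
  obtain ⟨x, y, hxy⟩ := hcop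
  obtain ⟨d1, c1⟩ := restr_deg t h1
  obtain ⟨d2, -⟩ := restr_deg t h2
  obtain ⟨dF, -⟩ := restr_deg t hF
  have hr0 : restr t H1 ≠ 0 := by
    intro h
    rw [h, Polynomial.coeff_zero] at c1
    exact hp c1.symm
  have hda : (restr t H1).natDegree = a :=
    le_antisymm d1 (Polynomial.le_natDegree_of_ne_zero (by rw [c1]; exact hp))
  set f := restr t F with hf
  set g1 := restr t H1
  set g2 := restr t H2
  set β := (f * y) % g1 with hβ
  set α := f * x + ((f * y) / g1) * g2 with hα
  have hfe : f = α * g1 + β * g2 := by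
    have := EuclideanDomain.div_add_mod (f * y) g1
    rw [← hβ] at this
    rw [hα]
    linear_combination -f * hxy + (-g2) * this
  have dβ : β.natDegree < a := by
    rw [← hda]
    apply Polynomial.natDegree_mod_lt
    rw [hda]; omega
  have dα : α.natDegree ≤ k - a := by
    by_cases h0 : α = 0
    · simp [h0]
    · have e : α * g1 = f - β * g2 := by linear_combination -hfe
      have := congrArg Polynomial.natDegree e
      rw [Polynomial.natDegree_mul h0 hr0, hda] at this
      have b1 := Polynomial.natDegree_sub_le f (β * g2)
      have b2 := Polynomial.natDegree_mul_le (p := β) (q := g2)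
      have : max f.natDegree (β * g2).natDegree ≤ k := max_le dF (by omega)
      omega
  obtain ⟨u, hu, hu2⟩ := lift_poly α (k - a) dα 2
  obtain ⟨v, hv, hv2⟩ := lift_poly β (k - a) (by omega) 2
  have hD : (F - u * H1 - v * H2).IsHomogeneous k := by
    refine (hF.sub ?_).sub ?_
    · have := hu.mul h1
      rwa [Nat.sub_add_cancel (by omega)] at this
    · have := hv.mul h2
      rwa [Nat.sub_add_cancel (by omega)] at this
  obtain ⟨K, hK⟩ := line_dvd hD t (by
    intro z
    rw [map_sub, map_sub, map_mul, map_mul, hu2 _ (by simp), hv2 _ (by simp), ← restr_eval,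
      ← restr_eval, ← restr_eval]
    change f.eval z - α.eval z * g1.eval z - β.eval z * g2.eval z = 0
    rw [hfe]
    simp)
  refine ⟨K, u, v, ?_, by linear_combination hK⟩
  apply hom_cancel hl hl0
  rw [← hK, show 1 + (k - 1) = k by omega]
  exact hD

lemma exists_good_pt {a : ℕ} {H : MvPolynomial (Fin 3) ℂ} (h : H.IsHomogeneous a) (h0 : H ≠ 0) :
    ∃ c0 c1, eval ![c0, c1, 1] H ≠ 0 := by
  have : H * X 2 ≠ 0 := mul_ne_zero h0 (X_ne_zero _)
  obtain ⟨v, hv⟩ : ∃ v, eval v (H * X 2) ≠ 0 := by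
    by_contra hc
    push Not at hc
    exact this (MvPolynomial.funext fun v => by rw [hc, map_zero])
  rw [map_mul, eval_X] at hv
  have hv1 := left_ne_zero_of_mul hv
  have hv2 := right_ne_zero_of_mul hv
  refine ⟨v 0 / v 2, v 1 / v 2, fun h3 => hv1 ?_⟩
  have := eval_smul_hom h (v 2) ![v 0 / v 2, v 1 / v 2, 1]
  rw [h3, mul_zero] at this
  rw [← this]
  congr 1
  apply congrArg
  funext i
  fin_cases i
  · simp; field_simp
  · simp; field_simp
  · simp

/-- A shear of the coordinates. -/
noncomputable def shear (c0 c1 : ℂ) : MvPolynomial (Fin 3) ℂ →ₐ[ℂ] MvPolynomial (Fin 3) ℂ :=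
  aeval ![X 0 + C c0 * X 2, X 1 + C c1 * X 2, X 2]

lemma shear_inv (c0 c1 : ℂ) (F : MvPolynomial (Fin 3) ℂ) :
    shear (-c0) (-c1) (shear c0 c1 F) = F := by
  have : (shear (-c0) (-c1)).comp (shear c0 c1) = AlgHom.id ℂ _ := by
    apply MvPolynomial.algHom_ext
    intro i
    fin_cases i <;> simp [shear, algHom_C, algebraMap_eq]
  exact congrArg (fun f => f F) this

lemma shear_inv' (c0 c1 : ℂ) (F : MvPolynomial (Fin 3) ℂ) :
    shear c0 c1 (shear (-c0) (-c1) F) = F := by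
  have := shear_inv (-c0) (-c1) F
  simpa using this

lemma shear_hom (c0 c1 : ℂ) {F : MvPolynomial (Fin 3) ℂ} {k : ℕ} (hF : F.IsHomogeneous k) :
    (shear c0 c1 F).IsHomogeneous k := by
  have := hF.aeval ![X 0 + C c0 * X 2, X 1 + C c1 * X 2, (X 2 : MvPolynomial (Fin 3) ℂ)] (n := 1) (by
    intro i
    fin_cases i
    · exact (isHomogeneous_X _ _).add ((isHomogeneous_X _ _).C_mul _)
    · exact (isHomogeneous_X _ _).add ((isHomogeneous_X _ _).C_mul _)
    · exact isHomogeneous_X _ _)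
  rwa [one_mul] at this

lemma shear_eval (c0 c1 : ℂ) (F : MvPolynomial (Fin 3) ℂ) :
    eval ![0, 0, 1] (shear c0 c1 F) = eval ![c0, c1, 1] F := by
  have : (eval ![0, 0, 1]).comp (shear c0 c1).toRingHom = eval ![c0, c1, 1] := by
    apply MvPolynomial.ringHom_ext
    · intro r; simp
    · intro i; fin_cases i <;> simp [shear]
  exact congrArg (fun f => f F) this

lemma ci_general {a : ℕ} (ha : 1 ≤ a) {H1 H2 : MvPolynomial (Fin 3) ℂ} (h1 : H1.IsHomogeneous a)
    (h2 : H2.IsHomogeneous a) (hrel : IsRelPrime H1 H2) (h0 : H1 ≠ 0) :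
    ∃ l : MvPolynomial (Fin 3) ℂ, l.IsHomogeneous 1 ∧ ∀ k, 2 * a ≤ k →
      ∀ F : MvPolynomial (Fin 3) ℂ, F.IsHomogeneous k → ∃ K u v : MvPolynomial (Fin 3) ℂ,
        K.IsHomogeneous (k - 1) ∧ F = l * K + u * H1 + v * H2 := by
  obtain ⟨c0, c1, hc⟩ := exists_good_pt h1 h0
  have hrel' : IsRelPrime (shear c0 c1 H1) (shear c0 c1 H2) := by
    intro d hd1 hd2
    have e1 := map_dvd (shear (-c0) (-c1)) hd1
    have e2 := map_dvd (shear (-c0) (-c1)) hd2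
    rw [shear_inv] at e1 e2
    have := (hrel e1 e2).map (shear c0 c1)
    rwa [shear_inv'] at this
  obtain ⟨l, hl, H⟩ := ci_special ha (shear_hom c0 c1 h1) (shear_hom c0 c1 h2) hrel'
    (by rwa [shear_eval])
  refine ⟨shear (-c0) (-c1) l, shear_hom _ _ hl, fun k hk F hF => ?_⟩
  obtain ⟨K, u, v, hK, he⟩ := H k hk _ (shear_hom c0 c1 hF)
  refine ⟨shear (-c0) (-c1) K, shear (-c0) (-c1) u, shear (-c0) (-c1) v, shear_hom _ _ hK, ?_⟩
  have := congrArg (shear (-c0) (-c1)) he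
  simpa [shear_inv] using this

lemma ci_indep {a : ℕ} (ha : 1 ≤ a) {H1 H2 : MvPolynomial (Fin 3) ℂ} (h1 : H1.IsHomogeneous a)
    (h2 : H2.IsHomogeneous a) (hrel : IsRelPrime H1 H2) (h0 : H1 ≠ 0) {Z : Finset (Proj 2)}
    (hZ1 : ∀ P ∈ Z, eval P.rep H1 = 0) (hZ2 : ∀ P ∈ Z, eval P.rep H2 = 0) {k : ℕ}
    (hk : 2 * a ≤ k) : Indep k Z := by
  obtain ⟨l, hl, H⟩ := ci_general ha h1 h2 hrel h0
  have hlP : ∀ P ∈ Z, eval P.rep l ≠ 0 := by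
    intro P hP h
    obtain ⟨i, hi⟩ := rep_exists_ne P
    obtain ⟨K, u, v, -, he⟩ := H k hk (X i ^ k) (isHomogeneous_X_pow i k)
    have := congrArg (eval P.rep) he
    simp [h, hZ1 P hP, hZ2 P hP] at this
    exact hi this.1
  have step : ∀ j, 2 * a ≤ j + 1 → Indep (j + 1) Z → Indep j Z := by
    intro j hj hI w hw
    have := hI (fun P => w P / eval P.rep l) (by
      intro F hF
      obtain ⟨K, u, v, hK, he⟩ := H (j + 1) hj F hF
      rw [← hw K hK]
      refine Finset.sum_congr rfl fun P hP => ?_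
      have := hlP P hP
      rw [he]
      simp only [map_add, map_mul, hZ1 P hP, hZ2 P hP]
      field_simp
      ring)
    intro P hP
    have h3 := this P hP
    simp only [div_eq_zero_iff] at h3
    exact h3.resolve_right (hlP P hP)
  obtain ⟨j, hj⟩ := exists_indep Z
  have big : Indep (k + j) Z := hj.of_le (by omega)
  clear hj
  induction j with
  | zero => exact big
  | succ n ih => exact ih (step (k + n) (by omega) big)


/-- Two independent forms of degree `m` vanishing on `A`, with the gcd split off. -/
lemma pencil {m : ℕ} {A : Finset (Proj 2)} (hI : Indep m A)
    (hr : A.card + 2 ≤ Nat.choose (m + 2) 2) :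
    ∃ (G H1 H2 : MvPolynomial (Fin 3) ℂ) (c e : ℕ), c + e = m ∧ 1 ≤ e ∧ G.IsHomogeneous c ∧
      H1.IsHomogeneous e ∧ H2.IsHomogeneous e ∧ G ≠ 0 ∧ H1 ≠ 0 ∧ IsRelPrime H1 H2 ∧
      (∀ P ∈ A, eval P.rep (G * H1) = 0) ∧ (∀ P ∈ A, eval P.rep (G * H2) = 0) := by
  have hk := hI.finrank_ker
  have h2 : 1 < Module.finrank ℂ (LinearMap.ker (evalMap 2 m A)) := by omega
  obtain ⟨x, hx⟩ := (Module.finrank_pos_iff_exists_ne_zero (R := ℂ)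
    (M := LinearMap.ker (evalMap 2 m A))).1 (lt_trans zero_lt_one h2)
  obtain ⟨y, hxy⟩ := exists_linearIndependent_pair_of_one_lt_finrank h2 hx
  replace hxy := (LinearIndependent.pair_iff (R := ℂ)).1 hxy
  have hy : y ≠ 0 := by
    rintro rfl
    have := hxy 0 1 (by simp)
    simp at this
  have hF1 : x.1.1 ≠ 0 := fun h => hx (Subtype.ext (Subtype.ext h))
  have hF2 : y.1.1 ≠ 0 := fun h => hy (Subtype.ext (Subtype.ext h))
  have hh1 : x.1.1.IsHomogeneous m := x.1.2
  have hh2 : y.1.1.IsHomogeneous m := y.1.2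
  obtain ⟨H1, H2, G, hrel, e1, e2⟩ :=
    UniqueFactorizationMonoid.exists_reduced_factors x.1.1 hF1 y.1.1
  have hn1 : G * H1 ≠ 0 := by rw [e1]; exact hF1
  have hn2 : G * H2 ≠ 0 := by rw [e2]; exact hF2
  have hG0 : G ≠ 0 := left_ne_zero_of_mul hn1
  obtain ⟨c, e, hce, hGc, hHe⟩ := hom_factor (p := G) (q := H1) (n := m) (by rw [e1]; exact hh1) hn1
  have hHe2 : H2.IsHomogeneous e := hom_cancel hGc hG0 (by rw [e2, hce]; exact hh2)
  refine ⟨G, H1, H2, c, e, hce, ?_, hGc, hHe, hHe2, hG0, right_ne_zero_of_mul hn1, hrel, ?_, ?_⟩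
  · by_contra he
    have he : e = 0 := by omega
    subst he
    have t1 := totalDegree_eq_zero_iff_eq_C.1 ((totalDegree_zero_iff_isHomogeneous _).2 hHe)
    have t2 := totalDegree_eq_zero_iff_eq_C.1 ((totalDegree_zero_iff_isHomogeneous _).2 hHe2)
    have := hxy (coeff 0 H2) (-(coeff 0 H1)) (by
      apply Subtype.ext
      apply Subtype.ext
      change coeff 0 H2 • x.1.1 + (-(coeff 0 H1)) • y.1.1 = 0
      rw [← e1, ← e2, smul_eq_C_mul, smul_eq_C_mul, C_neg, ← t1, ← t2]
      ring)
    apply right_ne_zero_of_mul hn1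
    rw [t1, neg_eq_zero.1 this.2, C_0]
  · rw [e1]; exact (mem_ker_evalMap x.1).1 x.2
  · rw [e2]; exact (mem_ker_evalMap y.1).1 y.2

lemma core {n : ℕ} {A B : Finset (Proj 2)} (a b : Proj 2 → ℂ)
    (hab : ∀ F : MvPolynomial (Fin 3) ℂ, F.IsHomogeneous (2 * (n + 1)) →
      ∑ P ∈ A, a P * eval P.rep F = ∑ P ∈ B, b P * eval P.rep F)
    (ha : ∀ P ∈ A, a P ≠ 0)
    (hkr : ∀ A' ⊆ A, A'.card ≤ Nat.choose (n + 2) 2 → Indep n A')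
    (hI : Indep (n + 1) A) (hr : A.card + 2 ≤ Nat.choose (n + 1 + 2) 2)
    (hB : B.card ≤ A.card) : B = A := by
  classical
  have hcat := (catalecticant a b hab ha hI).2 hB
  by_cases hc : A.card ≤ Nat.choose (n + 2) 2
  · have hIn := hkr A subset_rfl hc
    have hsub : B ⊆ A := fun Q hQ => mem_of_vanish hIn fun F hF hv => hcat F hF hv Q hQ
    exact Finset.eq_of_subset_of_card_le hsub (catalecticant a b hab ha hI).1
  obtain ⟨G, H1, H2, c, e, hce, he, hG, hH1, hH2, hG0, hH10, hrel, hv1, hv2⟩ := pencil hI hr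
  have hv1B := hcat _ (hce ▸ hG.mul hH1) hv1
  have hv2B := hcat _ (hce ▸ hG.mul hH2) hv2
  -- the difference measure
  let w : Proj 2 → ℂ := fun P => (if P ∈ A then a P else 0) - (if P ∈ B then b P else 0)
  have hw : ∀ F : MvPolynomial (Fin 3) ℂ, F.IsHomogeneous (2 * (n + 1)) →
      ∑ P ∈ A ∪ B, w P * eval P.rep F = 0 := by
    intro F hF
    simp only [w, sub_mul, Finset.sum_sub_distrib, ite_mul, zero_mul]
    rw [← Finset.sum_filter, ← Finset.sum_filter, Finset.filter_mem_eq_inter,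
      Finset.filter_mem_eq_inter, Finset.union_inter_cancel_left, Finset.union_inter_cancel_right,
      hab F hF, sub_self]
  let Z' := (A ∪ B).filter (fun P => eval P.rep G ≠ 0)
  have hZ' : Indep (2 * (n + 1) - c) Z' := by
    refine ci_indep he hH1 hH2 hrel hH10 ?_ ?_ (by omega)
    · intro P hP
      obtain ⟨h1, h2⟩ := Finset.mem_filter.1 hP
      have : eval P.rep (G * H1) = 0 := (Finset.mem_union.1 h1).elim (hv1 P) (hv1B P)
      rw [map_mul] at this
      exact (mul_eq_zero.1 this).resolve_left h2
    · intro P hP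
      obtain ⟨h1, h2⟩ := Finset.mem_filter.1 hP
      have : eval P.rep (G * H2) = 0 := (Finset.mem_union.1 h1).elim (hv2 P) (hv2B P)
      rw [map_mul] at this
      exact (mul_eq_zero.1 this).resolve_left h2
  have hwz : ∀ P ∈ A ∪ B, eval P.rep G ≠ 0 → w P = 0 := by
    intro P hP hGP
    have := hZ' (fun P => w P * eval P.rep G) (by
      intro K hK
      have h3 := hw (G * K) (by
        have := hG.mul hK
        rwa [Nat.add_sub_cancel' (by omega)] at this)
      rw [← h3]
      simp only [Z']
      rw [Finset.sum_filter]
      refine Finset.sum_congr rfl fun Q _ => ?_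
      split_ifs with h
      · rw [map_mul]; ring
      · push Not at h
        rw [map_mul, h]; ring) P (Finset.mem_filter.2 ⟨hP, hGP⟩)
    exact (mul_eq_zero.1 this).resolve_right hGP
  have hAB : A.filter (fun P => eval P.rep G ≠ 0) ⊆ B.filter (fun P => eval P.rep G ≠ 0) := by
    intro P hP
    obtain ⟨h1, h2⟩ := Finset.mem_filter.1 hP
    refine Finset.mem_filter.2 ⟨?_, h2⟩
    by_contra hPB
    have := hwz P (Finset.mem_union_left _ h1) h2
    simp only [w, if_pos h1, if_neg hPB, sub_zero] at this
    exact ha P h1 this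
  have hab' : ∀ F : MvPolynomial (Fin 3) ℂ, F.IsHomogeneous (2 * (n + 1)) →
      ∑ P ∈ A.filter (fun P => eval P.rep G = 0), a P * eval P.rep F
        = ∑ P ∈ B.filter (fun P => eval P.rep G = 0), b P * eval P.rep F := by
    intro F hF
    have h1 : ∑ P ∈ (A ∪ B).filter (fun P => eval P.rep G = 0), w P * eval P.rep F = 0 := by
      refine Eq.trans ?_ (hw F hF)
      rw [Finset.sum_filter]
      refine Finset.sum_congr rfl fun Q hQ => ?_
      split_ifs with h
      · rfl
      · rw [hwz Q hQ h, zero_mul]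
    simp only [w, sub_mul, Finset.sum_sub_distrib, ite_mul, zero_mul] at h1
    have f1 : ((A ∪ B).filter (fun P => eval P.rep G = 0)).filter (fun P => P ∈ A)
        = A.filter (fun P => eval P.rep G = 0) := by
      ext P
      simp only [Finset.mem_filter, Finset.mem_union]
      tauto
    have f2 : ((A ∪ B).filter (fun P => eval P.rep G = 0)).filter (fun P => P ∈ B)
        = B.filter (fun P => eval P.rep G = 0) := by
      ext P
      simp only [Finset.mem_filter, Finset.mem_union]
      tauto
    rw [← Finset.sum_filter, ← Finset.sum_filter, f1, f2, sub_eq_zero] at h1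
    exact h1
  have cA := Finset.card_filter_add_card_filter_not (s := A) (fun P => eval P.rep G = 0)
  have cB := Finset.card_filter_add_card_filter_not (s := B) (fun P => eval P.rep G = 0)
  have cAB : (A.filter (fun P => ¬ eval P.rep G = 0)).card
      ≤ (B.filter (fun P => ¬ eval P.rep G = 0)).card := Finset.card_le_card hAB
  have hsmall : (A.filter (fun P => eval P.rep G = 0)).card ≤ Nat.choose (n + 2) 2 := by
    by_contra hbig
    push Not at hbig
    obtain ⟨S, hS, hSc⟩ := Finset.exists_subset_card_eq hbig.le
    have hSI := hkr S (hS.trans (Finset.filter_subset _ _)) hSc.le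
    have hd := hSI.finrank_ker
    have hker : LinearMap.ker (evalMap 2 n S) = ⊥ := by
      rw [← Submodule.finrank_eq_zero]; omega
    have hhom : (G * X 0 ^ (n - c) : MvPolynomial (Fin 3) ℂ).IsHomogeneous n := by
      have := hG.mul (isHomogeneous_X_pow (R := ℂ) (0 : Fin 3) (n - c))
      rwa [Nat.add_sub_cancel' (by omega)] at this
    have hmem : (⟨_, hhom⟩ : homogeneousSubmodule (Fin 3) ℂ n) ∈ LinearMap.ker (evalMap 2 n S) := by
      rw [mem_ker_evalMap]
      intro P hP
      rw [map_mul, (Finset.mem_filter.1 (hS hP)).2, zero_mul]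
    rw [hker, Submodule.mem_bot] at hmem
    have := congrArg Subtype.val hmem
    exact mul_ne_zero hG0 (pow_ne_zero _ (X_ne_zero _)) this
  have hAGI := hkr _ (Finset.filter_subset _ _) hsmall
  have haG : ∀ P ∈ A.filter (fun P => eval P.rep G = 0), a P ≠ 0 := fun P hP =>
    ha P (Finset.mem_filter.1 hP).1
  obtain ⟨k1, k2⟩ := catalecticant a b hab' haG hAGI.succ
  have hle : (B.filter (fun P => eval P.rep G = 0)).card
      ≤ (A.filter (fun P => eval P.rep G = 0)).card := by omega
  have hBA : B.filter (fun P => eval P.rep G = 0) ⊆ A.filter (fun P => eval P.rep G = 0) :=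
    fun Q hQ => mem_of_vanish hAGI fun F hF hv => k2 hle F hF hv Q hQ
  have hBA2 := Finset.eq_of_subset_of_card_le hBA k1
  have hsub : A ⊆ B := by
    intro P hP
    by_cases h : eval P.rep G = 0
    · have : P ∈ B.filter (fun P => eval P.rep G = 0) := by
        rw [hBA2]; exact Finset.mem_filter.2 ⟨hP, h⟩
      exact (Finset.mem_filter.1 this).1
    · exact (Finset.mem_filter.1 (hAB (Finset.mem_filter.2 ⟨hP, h⟩))).1
  exact (Finset.eq_of_subset_of_card_le hsub hB).symm

lemma computes_iff {d : ℕ} {B : Finset (Proj 2)} {T : MvPolynomial (Fin 3) ℂ} :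
    Computes 2 d B T ↔ ∃ b : Proj 2 → ℂ, ∑ P ∈ B, b P • vero 2 d P = T := by
  unfold Computes
  constructor
  · intro h
    rw [Submodule.mem_span_image_finset_iff_exists_fun] at h
    obtain ⟨c, hc⟩ := h
    refine ⟨fun P => if hP : P ∈ B then c ⟨P, hP⟩ else 0, ?_⟩
    rw [← hc, ← Finset.sum_coe_sort]
    refine Finset.sum_congr rfl fun P _ => ?_
    simp only [dif_pos P.2]
  · rintro ⟨b, rfl⟩
    exact Submodule.sum_mem _ fun P hP => Submodule.smul_mem _ _
      (Submodule.subset_span ⟨P, hP, rfl⟩)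

lemma apolar_two {d : ℕ} {A B : Finset (Proj 2)} {a b : Proj 2 → ℂ}
    (h : ∑ P ∈ A, a P • vero 2 d P = ∑ P ∈ B, b P • vero 2 d P)
    (F : MvPolynomial (Fin 3) ℂ) (hF : F.IsHomogeneous d) :
    ∑ P ∈ A, a P * eval P.rep F = ∑ P ∈ B, b P * eval P.rep F := by
  classical
  have key : ∑ P ∈ A ∪ B, ((if P ∈ A then a P else 0) - (if P ∈ B then b P else 0)) •
      vero 2 d P = 0 := by
    simp only [sub_smul, Finset.sum_sub_distrib, ite_smul, zero_smul]
    rw [← Finset.sum_filter, ← Finset.sum_filter, Finset.filter_mem_eq_inter,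
      Finset.filter_mem_eq_inter, Finset.union_inter_cancel_left, Finset.union_inter_cancel_right,
      h, sub_self]
  have h1 := (apolar d _ _).1 key F hF
  simp only [sub_mul, Finset.sum_sub_distrib, ite_mul, zero_mul] at h1
  rw [← Finset.sum_filter, ← Finset.sum_filter, Finset.filter_mem_eq_inter,
      Finset.filter_mem_eq_inter, Finset.union_inter_cancel_left, Finset.union_inter_cancel_right,
      sub_eq_zero] at h1
  exact h1

/-- Theorem (even case, identifiability): if `d = 2m`, `m ≥ 2`,
`k_{m-1}(A) = min{binom(m+1,2), r}`, `h_A(m) = r` and `r ≤ binom(m+2,2) - 2`,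
then `T` has rank `r` and is identifiable. -/
theorem stmt0 (m : ℕ) (hm : 2 ≤ m) (d : ℕ) (hd : d = 2 * m)
    (T : MvPolynomial (Fin 3) ℂ) (hT0 : T ≠ 0) (hTh : T.IsHomogeneous d)
    (A : Finset (Proj 2)) (hA : NRComputes 2 d A T) (r : ℕ) (hr : r = A.card)
    (hk : kruskalRank 2 (m - 1) A = min (Nat.choose (m + 1) 2) r)
    (hh : hilbN 2 A m = r)
    (hrb : r ≤ Nat.choose (m + 2) 2 - 2) :
    waringRank 2 d T = r ∧ Identifiable 2 d T := by
  obtain ⟨n, rfl⟩ : ∃ n, m = n + 1 := ⟨m - 1, by omega⟩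
  subst hd hr
  obtain ⟨hAc, hAn⟩ := hA
  obtain ⟨a, haT⟩ := computes_iff.1 hAc
  have ha : ∀ P ∈ A, a P ≠ 0 := by
    intro P hP h0
    refine hAn (A.erase P) (Finset.erase_ssubset hP) (computes_iff.2 ⟨a, ?_⟩)
    rw [← haT, ← Finset.add_sum_erase A _ hP, h0, zero_smul, zero_add]
  have hI : Indep (n + 1) A := hilbN_eq_card_iff.1 hh
  have hkr : ∀ A' ⊆ A, A'.card ≤ Nat.choose (n + 2) 2 → Indep n A' := by
    intro A' hA' hc
    have hmem := Nat.sSup_mem (s := {k | k ≤ A.card ∧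
      ∀ A' ⊆ A, A'.card ≤ k → LinearIndependent ℂ (fun P : A' => vero 2 n P.1)})
      ⟨0, Nat.zero_le _, fun A' _ h => by
        have : IsEmpty A' := by
          rw [Finset.isEmpty_coe_sort]; exact Finset.card_eq_zero.1 (Nat.le_zero.1 h)
        exact linearIndependent_empty_type⟩ ⟨A.card, fun k hk => hk.1⟩
    apply indep_of_linearIndependent
    apply hmem.2 A' hA'
    change A'.card ≤ kruskalRank 2 (n + 1 - 1) A
    rw [hk]
    exact le_min hc (Finset.card_le_card hA')
  have h2 : 2 ≤ Nat.choose (n + 1 + 2) 2 := by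
    have := two_choose (n + 1)
    nlinarith
  have hr2 : A.card + 2 ≤ Nat.choose (n + 1 + 2) 2 := by omega
  have hrank : waringRank 2 (2 * (n + 1)) T = A.card := by
    apply le_antisymm
    · exact Nat.sInf_le ⟨A, rfl, hAc⟩
    · refine le_csInf ⟨_, A, rfl, hAc⟩ ?_
      rintro _ ⟨B, rfl, hB⟩
      obtain ⟨b, hbT⟩ := computes_iff.1 hB
      exact (catalecticant a b (apolar_two (haT.trans hbT.symm)) ha hI).1
  refine ⟨hrank, A, ⟨hrank.symm, hAc⟩, ?_⟩
  rintro B ⟨hBc, hB⟩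
  obtain ⟨b, hbT⟩ := computes_iff.1 hB
  exact core a b (apolar_two (haT.trans hbT.symm)) ha hkr hI hr2 (by omega)
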